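/- Let T be a tree on vertex set V and let H be a rooted tree over V such that for any two vertices x, y ∈ V, the path in T between x and y contains LCA_H(x,y). Then for every node z, every vertex of Γ[C(z)] is an ancestor of z in H. -/

import Mathlib

open SimpleGraph

/-- `w` lies on every path between `a` and `b` in `G` (in a tree: on *the* unique path). -/
def OnPath {V : Type*} (G : SimpleGraph V) (a b w : V) : Prop :=
  ∀ p : G.Walk a b, p.IsPath → w ∈ p.support

/-- In the tree `H` rooted at `g`, `y` is an ancestor of `x`. -/
def IsAncestor {V : Type*} (H : SimpleGraph V) (g y x : V) : Prop :=
  y ≠ x ∧ OnPath H g x y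

/-- `C(z)`: the set consisting of `z` together with all its descendants in `H` rooted at `g`. -/
def descSet {V : Type*} (H : SimpleGraph V) (g z : V) : Set V :=
  {x | x = z ∨ IsAncestor H g z x}

/-- Depth of `x` in `H` rooted at `g`: number of nodes on the path from `g` to `x`. -/
noncomputable def depthIn {V : Type*} (H : SimpleGraph V) (g x : V) : ℕ :=
  H.dist g x + 1

/-- `w` is a least common ancestor of `x` and `y` in `H` rooted at `g`. -/
def IsLCA {V : Type*} (H : SimpleGraph V) (g x y w : V) : Prop :=
  OnPath H g x w ∧ OnPath H g y w ∧
    ∀ w' : V, OnPath H g x w' → OnPath H g y w' → depthIn H g w' ≤ depthIn H g w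

/-- `C` is a component of `T`: the induced subgraph is connected. -/
def IsComp {V : Type*} (T : SimpleGraph V) (C : Set V) : Prop :=
  (T.induce C).Connected

/-- The neighborhood `Γ[C]`: vertices outside `C` adjacent in `T` to some vertex of `C`. -/
def nbhd {V : Type*} (T : SimpleGraph V) (C : Set V) : Set V :=
  {x | x ∉ C ∧ ∃ y ∈ C, T.Adj x y}

/-- In a tree, lying on one path between two vertices is the same as lying on every such path. -/
theorem onPath_of_mem_support {V : Type*} {H : SimpleGraph V} (hH : H.IsTree) {a b w : V}
    {p : H.Walk a b} (hp : p.IsPath) (hw : w ∈ p.support) : OnPath H a b w := by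
  intro q hq
  rwa [(hH.existsUnique_path a b).unique hq hp]

theorem OnPath.trans {V : Type*} {H : SimpleGraph V} {g x y z : V}
    (hz : OnPath H g y z) (hy : OnPath H g x y) : OnPath H g x z := by
  classical
  intro p hp
  exact p.support_takeUntil_subset_support (hy p hp) (hz _ (hp.takeUntil (hy p hp)))

/-- Two vertices on the root path of a common vertex are comparable. -/
theorem OnPath.total {V : Type*} {H : SimpleGraph V} (hH : H.IsTree) {g x y z : V}
    (hx : OnPath H g y x) (hz : OnPath H g y z) : OnPath H g x z ∨ OnPath H g z x := by
  classical
  obtain ⟨p, hp, -⟩ := hH.existsUnique_path g y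
  have hxp := hx p hp
  have hzp := hz p hp
  rw [← p.take_spec hxp, Walk.mem_support_append_iff] at hzp
  rcases hzp with h | h
  · exact .inl (onPath_of_mem_support hH (hp.takeUntil hxp) h)
  · have hq : ((p.takeUntil x hxp).append ((p.dropUntil x hxp).takeUntil z h)).IsPath := by
      apply Walk.IsPath.of_append_left (q := (p.dropUntil x hxp).dropUntil z h)
      rwa [← Walk.append_assoc, Walk.take_spec, Walk.take_spec]
    exact .inr (onPath_of_mem_support hH hq
      (Walk.mem_support_append_iff _ _ |>.2 (.inl (Walk.end_mem_support _))))

theorem exists_isLCA {V : Type*} {H : SimpleGraph V} (hH : H.IsTree) (g x y : V) :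
    ∃ w, IsLCA H g x y w := by
  obtain ⟨p, hp, -⟩ := hH.existsUnique_path g x
  have hfin : {w | OnPath H g x w ∧ OnPath H g y w}.Finite :=
    p.support.finite_toSet.subset fun w hw => hw.1 p hp
  obtain ⟨w, hw, hmax⟩ := Set.exists_max_image _ (depthIn H g) hfin
    ⟨g, fun q _ => q.start_mem_support, fun q _ => q.start_mem_support⟩
  exact ⟨w, hw.1, hw.2, fun w' h₁ h₂ => hmax w' ⟨h₁, h₂⟩⟩

theorem mem_descSet_iff {V : Type*} {H : SimpleGraph V} {g z x : V} :
    x ∈ descSet H g z ↔ OnPath H g x z := by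
  constructor
  · rintro (rfl | h)
    · exact fun q _ => q.end_mem_support
    · exact h.2
  · intro h
    by_cases hxz : x = z
    · exact .inl hxz
    · exact .inr ⟨Ne.symm hxz, h⟩

/-- If `H` is a rooted tree over the vertex set of a tree `T` satisfying the LCA property of
tree decompositions, then every neighbor of `C(z)` is an ancestor of `z` in `H`. -/
theorem neighborhood_in_ancestors {V : Type*} (T H : SimpleGraph V) (g : V)
    (hT : T.IsTree) (hH : H.IsTree)
    (hlca : ∀ x y w : V, IsLCA H g x y w → OnPath T x y w) :
    ∀ z : V, ∀ x ∈ nbhd T (descSet H g z), IsAncestor H g x z := by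
  rintro z x ⟨hxC, y, hyC, hadj⟩
  rw [mem_descSet_iff] at hxC hyC
  have hne : x ≠ z := by
    rintro rfl
    exact hxC fun q _ => q.end_mem_support
  obtain ⟨w, hw⟩ := exists_isLCA hH g x y
  have hmem := hlca x y w hw hadj.toWalk (Walk.IsPath.of_adj hadj)
  have hwxy : w = x ∨ w = y := by simpa using hmem
  rcases hwxy with rfl | rfl
  · exact ⟨hne, (hw.2.1.total hH hyC).resolve_left hxC⟩
  · exact absurd (hyC.trans hw.1) hxC
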